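/- arXiv:1705.10832 — 2 statements merged into one kernel-verified Lean document; each statement's English description precedes it below -/
import Mathlib

section
/- Let X, Y, Z be Banach spaces and B : X × Y → Z a product with constant C₀, i.e. a bilinear map with ‖B(x,y)‖_Z ≤ C₀‖x‖_X‖y‖_Y. Let I ⊆ ℝ be a bounded interval, s ∈ (0,1) and p ∈ [1,∞]. Let f : I → X satisfy ‖f(x)‖ ≤ M_f for all x ∈ I and ‖f(x)−f(y)‖ ≤ H_f |x−y|^s for all x, y ∈ I, and let g : I → Y be strongly measurable with ‖g‖_{L^p(I;Y)} ≤ N_g and, for every h with 0 < h ≤ 1, ‖g(·+h) − g‖_{L^p(I_h;Y)} ≤ S_g · h^s, where I_h := {x ∈ I : x+h ∈ I}. Then the function φ(x) := B(f(x),g(x)) satisfies ‖φ‖_{L^p(I;Z)} ≤ C₀ M_f N_g and, for every 0 < h ≤ 1, ‖φ(·+h) − φ‖_{L^p(I_h;Z)} ≤ C₀ (M_f S_g + H_f N_g) · h^s. -/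
open MeasureTheory
open scoped ENNReal

/-- Let `B : X × Y → Z` be a product with constant `C₀` between Banach
spaces, `I ⊆ ℝ` a bounded interval, `s ∈ (0,1)`, `p ∈ [1,∞]`.  If `f : I → X` is bounded by
`M_f` and `s`-Hölder with constant `H_f`, and `g : I → Y` is strongly measurable with
`‖g‖_{L^p(I)} ≤ N_g` and `‖g(·+h) − g‖_{L^p(I_h)} ≤ S_g h^s` for all `0 < h ≤ 1`, then
`φ = B(f,g)` satisfies `‖φ‖_{L^p(I)} ≤ C₀ M_f N_g` and
`‖φ(·+h) − φ‖_{L^p(I_h)} ≤ C₀ (M_f S_g + H_f N_g) h^s` for all `0 < h ≤ 1`. -/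
theorem stmt5
    {X Y Z : Type*}
    [NormedAddCommGroup X] [NormedSpace ℝ X] [CompleteSpace X]
    [NormedAddCommGroup Y] [NormedSpace ℝ Y] [CompleteSpace Y]
    [NormedAddCommGroup Z] [NormedSpace ℝ Z] [CompleteSpace Z]
    (B : X →ₗ[ℝ] Y →ₗ[ℝ] Z) (C₀ : ℝ) (hC₀ : 0 ≤ C₀)
    (hB : ∀ (x : X) (y : Y), ‖B x y‖ ≤ C₀ * ‖x‖ * ‖y‖)
    (I : Set ℝ) (hIint : I.OrdConnected) (hIbdd : Bornology.IsBounded I)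
    (s : ℝ) (hs : s ∈ Set.Ioo (0 : ℝ) 1) (p : ℝ≥0∞) (hp : 1 ≤ p)
    (f : ℝ → X) (Mf Hf : ℝ)
    (hfM : ∀ x ∈ I, ‖f x‖ ≤ Mf)
    (hfH : ∀ x ∈ I, ∀ y ∈ I, ‖f x - f y‖ ≤ Hf * |x - y| ^ s)
    (g : ℝ → Y) (hg : AEStronglyMeasurable g (volume.restrict I))
    (Ng Sg : ℝ≥0∞)
    (hgN : eLpNorm g p (volume.restrict I) ≤ Ng)
    (hgS : ∀ h : ℝ, 0 < h → h ≤ 1 →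
      eLpNorm (fun x => g (x + h) - g x) p
          (volume.restrict {x | x ∈ I ∧ x + h ∈ I})
        ≤ Sg * ENNReal.ofReal (h ^ s)) :
    eLpNorm (fun x => B (f x) (g x)) p (volume.restrict I)
        ≤ ENNReal.ofReal (C₀ * Mf) * Ng ∧
    ∀ h : ℝ, 0 < h → h ≤ 1 →
      eLpNorm (fun x => B (f (x + h)) (g (x + h)) - B (f x) (g x)) p
          (volume.restrict {x | x ∈ I ∧ x + h ∈ I})
        ≤ ENNReal.ofReal C₀ * (ENNReal.ofReal Mf * Sg + ENNReal.ofReal Hf * Ng) *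
            ENNReal.ofReal (h ^ s) := by
  have hφ : ∀ x ∈ I, ‖B (f x) (g x)‖ ≤ C₀ * Mf * ‖g x‖ := fun x hx =>
    (hB _ _).trans (by gcongr; exact hfM x hx)
  refine ⟨?_, fun h h0 h1 => ?_⟩
  · refine (eLpNorm_le_mul_eLpNorm_of_ae_le_mul ?_ p).trans (by gcongr)
    exact (ae_restrict_iff' hIint.measurableSet).2 (.of_forall hφ)
  set J : Set ℝ := {x | x ∈ I ∧ x + h ∈ I}
  have hJmeas : MeasurableSet J :=
    hIint.measurableSet.inter (measurable_add_const h hIint.measurableSet)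
  have hJI : J ⊆ I := fun x hx => hx.1
  have hgJ : AEStronglyMeasurable g (volume.restrict J) :=
    hg.mono_measure (Measure.restrict_mono hJI le_rfl)
  have hshift : AEStronglyMeasurable (fun x => g (x + h)) (volume.restrict J) :=
    (hg.comp_measurePreserving
      ((measurePreserving_add_right volume h).restrict_preimage hIint.measurableSet)).mono_measure
      (Measure.restrict_mono (fun x hx => hx.2) le_rfl)
  set u : ℝ → ℝ := fun x => max Mf 0 * ‖g (x + h) - g x‖ with hu
  set v : ℝ → ℝ := fun x => max Hf 0 * h ^ s * ‖g x‖ with hv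
  have hhs : 0 ≤ h ^ s := Real.rpow_nonneg h0.le s
  have hpt : ∀ x ∈ J, ‖B (f (x + h)) (g (x + h)) - B (f x) (g x)‖ ≤ C₀ * ‖(u + v) x‖ := by
    intro x hx
    have hsplit : B (f (x + h)) (g (x + h)) - B (f x) (g x)
        = B (f (x + h)) (g (x + h) - g x) + B (f (x + h) - f x) (g x) := by
      simp only [map_sub, LinearMap.sub_apply]
      abel
    have hM : ‖f (x + h)‖ ≤ max Mf 0 := (hfM _ hx.2).trans (le_max_left _ _)
    have hH : ‖f (x + h) - f x‖ ≤ max Hf 0 * h ^ s := by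
      have := hfH _ hx.2 _ hx.1
      rw [add_sub_cancel_left, abs_of_pos h0] at this
      exact this.trans (by gcongr; exact le_max_left _ _)
    calc ‖B (f (x + h)) (g (x + h)) - B (f x) (g x)‖
        ≤ C₀ * ‖f (x + h)‖ * ‖g (x + h) - g x‖ + C₀ * ‖f (x + h) - f x‖ * ‖g x‖ := by
          rw [hsplit]
          exact (norm_add_le _ _).trans (add_le_add (hB _ _) (hB _ _))
      _ ≤ C₀ * max Mf 0 * ‖g (x + h) - g x‖ + C₀ * (max Hf 0 * h ^ s) * ‖g x‖ := by gcongr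
      _ = C₀ * (u + v) x := by simp only [hu, hv, Pi.add_apply]; ring
      _ ≤ C₀ * ‖(u + v) x‖ := by gcongr; exact Real.le_norm_self _
  have hule : eLpNorm u p (volume.restrict J)
      ≤ ENNReal.ofReal Mf * (Sg * ENNReal.ofReal (h ^ s)) := by
    refine (eLpNorm_le_mul_eLpNorm_of_ae_le_mul (c := max Mf 0)
      (g := fun x => g (x + h) - g x) (.of_forall fun x => ?_) p).trans ?_
    · simp [hu, abs_of_nonneg (le_max_right Mf 0)]
    · rw [ENNReal.ofReal_max, ENNReal.ofReal_zero, max_eq_left zero_le]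
      gcongr
      exact hgS h h0 h1
  have hvle : eLpNorm v p (volume.restrict J)
      ≤ ENNReal.ofReal Hf * ENNReal.ofReal (h ^ s) * Ng := by
    refine (eLpNorm_le_mul_eLpNorm_of_ae_le_mul (c := max Hf 0 * h ^ s)
      (g := g) (.of_forall fun x => ?_) p).trans ?_
    · simp [hv, abs_of_nonneg hhs, abs_of_nonneg (le_max_right Hf 0)]
    · rw [ENNReal.ofReal_mul (le_max_right _ _), ENNReal.ofReal_max, ENNReal.ofReal_zero,
        max_eq_left zero_le]
      gcongr
      exact (eLpNorm_mono_measure g (Measure.restrict_mono hJI le_rfl)).trans hgN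
  calc eLpNorm (fun x => B (f (x + h)) (g (x + h)) - B (f x) (g x)) p (volume.restrict J)
      ≤ ENNReal.ofReal C₀ * eLpNorm (u + v) p (volume.restrict J) :=
        eLpNorm_le_mul_eLpNorm_of_ae_le_mul
          ((ae_restrict_iff' hJmeas).2 (.of_forall hpt)) p
    _ ≤ ENNReal.ofReal C₀ * (eLpNorm u p (volume.restrict J)
          + eLpNorm v p (volume.restrict J)) := by
        gcongr
        exact eLpNorm_add_le ((hshift.sub hgJ).norm.const_mul _) (hgJ.norm.const_mul _) hp
    _ ≤ ENNReal.ofReal C₀ * (ENNReal.ofReal Mf * (Sg * ENNReal.ofReal (h ^ s))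
          + ENNReal.ofReal Hf * ENNReal.ofReal (h ^ s) * Ng) := by gcongr
    _ = _ := by ring
end

section
/- Let E₀, E, E₁ be Banach spaces, let ι₁ : E₁ → E and ι₀ : E → E₀ be bounded linear maps, let θ ∈ (0,1) and C₀ > 0, and assume ‖ι₁ x‖_E ≤ C₀ ‖ι₀(ι₁ x)‖_{E₀}^{1−θ} ‖x‖_{E₁}^θ for all x ∈ E₁. Let p ∈ [1,∞), let I = [a,b] ⊆ ℝ be a closed bounded interval, let f : ℝ → E₁ be strongly measurable with finite ‖f‖_{L^p(I;E₁)}, and let g : ℝ → E₀ be strongly measurable with finite ‖g‖_{L^p(I;E₀)} such that ι₀(ι₁(f(d))) − ι₀(ι₁(f(c))) = ∫_c^d g(t) dt (Bochner integral) for all c ≤ d in I. Then for every h with 0 < h ≤ 1, ( ∫_{I_h} ‖ι₁(f(x+h)) − ι₁(f(x))‖_E^p dx )^{1/p} ≤ h^{1−θ} · C₀ · ‖g‖_{L^p(I;E₀)}^{1−θ} · ( 2 ‖f‖_{L^p(I;E₁)} )^θ, where I_h := {x ∈ I : x+h ∈ I}. In particular, ι₁ ∘ f belongs to the Besov space B^{1−θ}_{p,∞}(I;E)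 with seminorm sup_{0<h≤1} h^{θ−1}‖ι₁∘f(·+h) − ι₁∘f‖_{L^p(I_h;E)} at most C₀ ‖g‖_{L^p(I;E₀)}^{1−θ} (2‖f‖_{L^p(I;E₁)})^θ. -/
open MeasureTheory
open scoped ENNReal

/-- The shift domain `I_h` of `I = [a,b]` is measurable. -/
theorem measurableSet_shift_Icc (a b h : ℝ) :
    MeasurableSet {x | x ∈ Set.Icc a b ∧ x + h ∈ Set.Icc a b} :=
  measurableSet_Icc.inter ((measurable_add_const h) measurableSet_Icc)

theorem lintegral_shift_lintegral_Ioc_le {a b h : ℝ} {G : ℝ → ℝ≥0∞} (hG : Measurable G) :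
    ∫⁻ x in {x | x ∈ Set.Icc a b ∧ x + h ∈ Set.Icc a b}, ∫⁻ t in Set.Ioc x (x + h), G t
      ≤ ENNReal.ofReal h * ∫⁻ t in Set.Icc a b, G t := by
  have hS : MeasurableSet {q : ℝ × ℝ | q.1 < q.2 ∧ q.2 ≤ q.1 + h} :=
    (measurableSet_lt measurable_fst measurable_snd).inter
      (measurableSet_le measurable_snd (measurable_fst.add_const h))
  calc ∫⁻ x in {x | x ∈ Set.Icc a b ∧ x + h ∈ Set.Icc a b}, ∫⁻ t in Set.Ioc x (x + h), G t
      = ∫⁻ x in {x | x ∈ Set.Icc a b ∧ x + h ∈ Set.Icc a b}, ∫⁻ t in Set.Icc a b,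
          {q : ℝ × ℝ | q.1 < q.2 ∧ q.2 ≤ q.1 + h}.indicator (fun q => G q.2) (x, t) := by
        refine setLIntegral_congr_fun (measurableSet_shift_Icc a b h) fun x hx => ?_
        have hsub : Set.Ioc x (x + h) ⊆ Set.Icc a b := fun t ht =>
          ⟨hx.1.1.trans ht.1.le, ht.2.trans hx.2.2⟩
        change _ = ∫⁻ t in Set.Icc a b, (Set.Ioc x (x + h)).indicator G t
        rw [lintegral_indicator measurableSet_Ioc, Measure.restrict_restrict measurableSet_Ioc,
          Set.inter_eq_left.2 hsub]
    _ = ∫⁻ t in Set.Icc a b, ∫⁻ x in {x | x ∈ Set.Icc a b ∧ x + h ∈ Set.Icc a b},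
          {q : ℝ × ℝ | q.1 < q.2 ∧ q.2 ≤ q.1 + h}.indicator (fun q => G q.2) (x, t) :=
        lintegral_lintegral_swap ((hG.comp measurable_snd).indicator hS).aemeasurable
    _ ≤ ∫⁻ t in Set.Icc a b, ENNReal.ofReal h * G t := by
        refine lintegral_mono fun t => (setLIntegral_le_lintegral _ _).trans ?_
        have hind : (fun x => {q : ℝ × ℝ | q.1 < q.2 ∧ q.2 ≤ q.1 + h}.indicator
            (fun q => G q.2) (x, t)) = (Set.Ico (t - h) t).indicator fun _ => G t := by
          ext x
          simp only [Set.indicator_apply, Set.mem_ofPred_eq, Set.mem_Ico, sub_le_iff_le_add,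
            and_comm]
        rw [hind, lintegral_indicator measurableSet_Ico, setLIntegral_const, Real.volume_Ico,
          sub_sub_cancel, mul_comm]
    _ = ENNReal.ofReal h * ∫⁻ t in Set.Icc a b, G t := lintegral_const_mul _ hG

/-- Difference quotients of a primitive: if `u` has derivative `g` on `[a,b]` in the integral
sense, then `‖u(·+h) − u‖_{L^p(I_h)} ≤ h ‖g‖_{L^p(I)}`. -/
theorem eLpNorm_shift_sub_le {F : Type*} [NormedAddCommGroup F] [NormedSpace ℝ F]
    {u g : ℝ → F} (hg : StronglyMeasurable g) {p : ℝ≥0∞} (hp : 1 ≤ p) (hp' : p ≠ ⊤)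
    {a b h : ℝ} (hh : 0 < h)
    (hftc : ∀ c ∈ Set.Icc a b, ∀ d ∈ Set.Icc a b, c ≤ d → u d - u c = ∫ t in c..d, g t) :
    eLpNorm (fun x => u (x + h) - u x) p
        (volume.restrict {x | x ∈ Set.Icc a b ∧ x + h ∈ Set.Icc a b})
      ≤ ENNReal.ofReal h * eLpNorm g p (volume.restrict (Set.Icc a b)) := by
  have hp0 : p ≠ 0 := (zero_lt_one.trans_le hp).ne'
  have hr : 0 < p.toReal := ENNReal.toReal_pos hp0 hp'
  have hpt : ∀ x ∈ {x | x ∈ Set.Icc a b ∧ x + h ∈ Set.Icc a b},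
      ‖u (x + h) - u x‖ₑ ^ p.toReal
        ≤ ENNReal.ofReal h ^ (p.toReal - 1) *
          ∫⁻ t in Set.Ioc x (x + h), ‖g t‖ₑ ^ p.toReal := by
    intro x hx
    have hle : x ≤ x + h := by linarith
    have hjensen : ‖u (x + h) - u x‖ₑ ≤ (∫⁻ t in Set.Ioc x (x + h), ‖g t‖ₑ ^ p.toReal)
        ^ (1 / p.toReal) * ENNReal.ofReal h ^ (1 - 1 / p.toReal) := by
      rw [hftc x hx.1 _ hx.2 hle, intervalIntegral.integral_of_le hle]
      refine (enorm_integral_le_lintegral_enorm _).trans ?_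
      have hmean := eLpNorm_le_eLpNorm_mul_rpow_measure_univ
        (μ := volume.restrict (Set.Ioc x (x + h))) hp hg.aestronglyMeasurable
      rwa [eLpNorm_one_eq_lintegral_enorm, eLpNorm_eq_lintegral_rpow_enorm_toReal hp0 hp',
        Measure.restrict_apply_univ, Real.volume_Ioc, add_sub_cancel_left, ENNReal.toReal_one,
        div_one] at hmean
    refine (ENNReal.rpow_le_rpow hjensen hr.le).trans_eq ?_
    rw [ENNReal.mul_rpow_of_nonneg _ _ hr.le, ← ENNReal.rpow_mul, ← ENNReal.rpow_mul,
      one_div_mul_cancel hr.ne', ENNReal.rpow_one, mul_comm, sub_mul, one_mul,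
      one_div_mul_cancel hr.ne']
  have hh0 : ENNReal.ofReal h ≠ 0 := (ENNReal.ofReal_pos.2 hh).ne'
  rw [eLpNorm_eq_lintegral_rpow_enorm_toReal hp0 hp',
    eLpNorm_eq_lintegral_rpow_enorm_toReal hp0 hp', one_div, ENNReal.rpow_inv_le_iff hr,
    ENNReal.mul_rpow_of_nonneg _ _ hr.le, ENNReal.rpow_inv_rpow hr.ne']
  have hG : Measurable fun t => ‖g t‖ₑ ^ p.toReal := hg.enorm.pow_const _
  calc ∫⁻ x in {x | x ∈ Set.Icc a b ∧ x + h ∈ Set.Icc a b}, ‖u (x + h) - u x‖ₑ ^ p.toReal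
      ≤ ∫⁻ x in {x | x ∈ Set.Icc a b ∧ x + h ∈ Set.Icc a b},
          ENNReal.ofReal h ^ (p.toReal - 1) *
            ∫⁻ t in Set.Ioc x (x + h), ‖g t‖ₑ ^ p.toReal :=
        setLIntegral_mono' (measurableSet_shift_Icc a b h) hpt
    _ = ENNReal.ofReal h ^ (p.toReal - 1) *
          ∫⁻ x in {x | x ∈ Set.Icc a b ∧ x + h ∈ Set.Icc a b},
            ∫⁻ t in Set.Ioc x (x + h), ‖g t‖ₑ ^ p.toReal :=
        lintegral_const_mul' _ _ (ENNReal.rpow_ne_top_of_ne_zero hh0 ENNReal.ofReal_ne_top)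
    _ ≤ ENNReal.ofReal h ^ (p.toReal - 1) *
          (ENNReal.ofReal h * ∫⁻ t in Set.Icc a b, ‖g t‖ₑ ^ p.toReal) := by
        gcongr
        exact lintegral_shift_lintegral_Ioc_le hG
    _ = ENNReal.ofReal h ^ p.toReal * ∫⁻ t in Set.Icc a b, ‖g t‖ₑ ^ p.toReal := by
        rw [← mul_assoc]
        congr 1
        nth_rewrite 2 [← ENNReal.rpow_one (ENNReal.ofReal h)]
        rw [← ENNReal.rpow_add _ _ hh0 ENNReal.ofReal_ne_top, sub_add_cancel]

theorem eLpNorm_shift_le {F : Type*} [NormedAddCommGroup F] {f : ℝ → F}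
    (hf : StronglyMeasurable f) (p : ℝ≥0∞) (a b h : ℝ) :
    eLpNorm (fun x => f (x + h)) p
        (volume.restrict {x | x ∈ Set.Icc a b ∧ x + h ∈ Set.Icc a b})
      ≤ eLpNorm f p (volume.restrict (Set.Icc a b)) := by
  have hmp : MeasurePreserving (fun x : ℝ => x + h)
      (volume.restrict ((fun x => x + h) ⁻¹' Set.Icc a b)) (volume.restrict (Set.Icc a b)) :=
    (measurePreserving_add_right volume h).restrict_preimage measurableSet_Icc
  calc _ ≤ eLpNorm (fun x => f (x + h)) p
        (volume.restrict ((fun x => x + h) ⁻¹' Set.Icc a b)) :=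
        eLpNorm_mono_measure _ (Measure.restrict_mono (fun _ hx => hx.2) le_rfl)
    _ = _ := eLpNorm_comp_measurePreserving hf.aestronglyMeasurable hmp

/-- The triangle inequality `‖f(·+h) − f‖_{L^p(I_h)} ≤ 2 ‖f‖_{L^p(I)}`. -/
theorem eLpNorm_shift_sub_le_two_mul {F : Type*} [NormedAddCommGroup F] {f : ℝ → F}
    (hf : StronglyMeasurable f) {p : ℝ≥0∞} (hp : 1 ≤ p) (a b h : ℝ) :
    eLpNorm (fun x => f (x + h) - f x) p
        (volume.restrict {x | x ∈ Set.Icc a b ∧ x + h ∈ Set.Icc a b})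
      ≤ 2 * eLpNorm f p (volume.restrict (Set.Icc a b)) := by
  rw [two_mul]
  exact (eLpNorm_sub_le (hf.comp_measurable (measurable_add_const h)).aestronglyMeasurable
    hf.aestronglyMeasurable hp).trans <| add_le_add (eLpNorm_shift_le hf p a b h) <|
      eLpNorm_mono_measure _ (Measure.restrict_mono (fun _ hx => hx.1) le_rfl)

/-- Hölder's inequality for a function dominated pointwise by a geometric mean. -/
theorem eLpNorm_le_rpow_mul_rpow_of_enorm_le {α F G H : Type*} [MeasurableSpace α]
    {μ : Measure α} [NormedAddCommGroup F] [NormedAddCommGroup G] [NormedAddCommGroup H]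
    {w : α → F} {u : α → G} {v : α → H} (hu : AEStronglyMeasurable u μ)
    (hv : AEStronglyMeasurable v μ) {θ : ℝ} (hθ₀ : 0 ≤ θ) (hθ₁ : θ ≤ 1) {C : ℝ≥0∞} (hC : C ≠ ⊤)
    {p : ℝ≥0∞} (hp : p ≠ 0) (hp' : p ≠ ⊤)
    (hw : ∀ x, ‖w x‖ₑ ≤ C * ‖u x‖ₑ ^ (1 - θ) * ‖v x‖ₑ ^ θ) :
    eLpNorm w p μ ≤ C * eLpNorm u p μ ^ (1 - θ) * eLpNorm v p μ ^ θ := by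
  have hr : 0 < p.toReal := ENNReal.toReal_pos hp hp'
  have hθ' : 0 ≤ 1 - θ := sub_nonneg.2 hθ₁
  simp only [eLpNorm_eq_lintegral_rpow_enorm_toReal hp hp', one_div]
  rw [ENNReal.rpow_inv_le_iff hr]
  calc ∫⁻ x, ‖w x‖ₑ ^ p.toReal ∂μ
      ≤ ∫⁻ x, C ^ p.toReal *
          ((‖u x‖ₑ ^ p.toReal) ^ (1 - θ) * (‖v x‖ₑ ^ p.toReal) ^ θ) ∂μ := by
        refine lintegral_mono fun x => (ENNReal.rpow_le_rpow (hw x) hr.le).trans_eq ?_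
        simp only [ENNReal.mul_rpow_of_nonneg _ _ hr.le, ← ENNReal.rpow_mul, mul_assoc,
          mul_comm p.toReal]
    _ = C ^ p.toReal *
          ∫⁻ x, (‖u x‖ₑ ^ p.toReal) ^ (1 - θ) * (‖v x‖ₑ ^ p.toReal) ^ θ ∂μ :=
        lintegral_const_mul' _ _ (ENNReal.rpow_ne_top_of_nonneg hr.le hC)
    _ ≤ C ^ p.toReal * ((∫⁻ x, ‖u x‖ₑ ^ p.toReal ∂μ) ^ (1 - θ) *
          (∫⁻ x, ‖v x‖ₑ ^ p.toReal ∂μ) ^ θ) := by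
        gcongr
        exact ENNReal.lintegral_mul_norm_pow_le (hu.enorm.pow_const _) (hv.enorm.pow_const _)
          hθ' hθ₀ (sub_add_cancel 1 θ)
    _ = _ := by
        simp only [ENNReal.mul_rpow_of_nonneg _ _ hr.le, ← ENNReal.rpow_mul, mul_assoc]
        congr 3 <;> field_simp

/-- (Embedding `L^p(I;X₁) ∩ W^1_p(I;X₀) ↪ B^{1−θ}_{p,∞}(I;X)`.)  Under the
interpolation inequality `‖ι₁ x‖_E ≤ C₀ ‖ι₀(ι₁ x)‖_{E₀}^{1−θ} ‖x‖_{E₁}^θ`, if `f ∈ L^p(I;E₁)`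
on `I = [a,b]` and `ι₀∘ι₁∘f` is absolutely continuous with Bochner-integrable derivative
`g ∈ L^p(I;E₀)`, then for all `0 < h ≤ 1`
`‖ι₁∘f(·+h) − ι₁∘f‖_{L^p(I_h;E)} ≤ h^{1−θ} C₀ ‖g‖_{L^p(I;E₀)}^{1−θ} (2‖f‖_{L^p(I;E₁)})^θ`. -/
theorem stmt9
    {E₀ E E₁ : Type*}
    [NormedAddCommGroup E₀] [NormedSpace ℝ E₀] [CompleteSpace E₀]
    [NormedAddCommGroup E] [NormedSpace ℝ E] [CompleteSpace E]
    [NormedAddCommGroup E₁] [NormedSpace ℝ E₁] [CompleteSpace E₁]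
    (ι₁ : E₁ →L[ℝ] E) (ι₀ : E →L[ℝ] E₀)
    (θ : ℝ) (hθ : θ ∈ Set.Ioo (0 : ℝ) 1) (C₀ : ℝ) (hC₀ : 0 < C₀)
    (hinterp : ∀ x : E₁, ‖ι₁ x‖ ≤ C₀ * ‖ι₀ (ι₁ x)‖ ^ (1 - θ) * ‖x‖ ^ θ)
    (p : ℝ≥0∞) (hp : 1 ≤ p) (hp' : p ≠ ⊤)
    (a b : ℝ) (hab : a ≤ b)
    (f : ℝ → E₁) (hf : StronglyMeasurable f)
    (hfLp : eLpNorm f p (volume.restrict (Set.Icc a b)) < ⊤)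
    (g : ℝ → E₀) (hg : StronglyMeasurable g)
    (hgLp : eLpNorm g p (volume.restrict (Set.Icc a b)) < ⊤)
    (hftc : ∀ c ∈ Set.Icc a b, ∀ d ∈ Set.Icc a b, c ≤ d →
      ι₀ (ι₁ (f d)) - ι₀ (ι₁ (f c)) = ∫ t in c..d, g t) :
    ∀ h : ℝ, 0 < h → h ≤ 1 →
      eLpNorm (fun x => ι₁ (f (x + h)) - ι₁ (f x)) p
          (volume.restrict {x | x ∈ Set.Icc a b ∧ x + h ∈ Set.Icc a b})
        ≤ ENNReal.ofReal (h ^ (1 - θ)) * ENNReal.ofReal C₀ *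
            eLpNorm g p (volume.restrict (Set.Icc a b)) ^ (1 - θ) *
            (2 * eLpNorm f p (volume.restrict (Set.Icc a b))) ^ θ := by
  intro h hh _
  have hθ₀ : 0 ≤ θ := hθ.1.le
  have hθ₁ : 0 ≤ 1 - θ := sub_nonneg.2 hθ.2.le
  set d : ℝ → E₁ := fun x => f (x + h) - f x with hd
  have hd_meas : StronglyMeasurable d :=
    (hf.comp_measurable (measurable_add_const h)).sub hf
  have hpt : ∀ x, ‖ι₁ (f (x + h)) - ι₁ (f x)‖ₑ
      ≤ ENNReal.ofReal C₀ * ‖ι₀ (ι₁ (d x))‖ₑ ^ (1 - θ) * ‖d x‖ₑ ^ θ := by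
    intro x
    rw [← map_sub, ← ofReal_norm, ← ofReal_norm, ← ofReal_norm,
      ENNReal.ofReal_rpow_of_nonneg (norm_nonneg _) hθ₁,
      ENNReal.ofReal_rpow_of_nonneg (norm_nonneg _) hθ₀, ← ENNReal.ofReal_mul hC₀.le,
      ← ENNReal.ofReal_mul (by positivity)]
    exact ENNReal.ofReal_le_ofReal (hinterp (d x))
  refine (eLpNorm_le_rpow_mul_rpow_of_enorm_le
    ((ι₀.comp ι₁).continuous.comp_stronglyMeasurable hd_meas).aestronglyMeasurable
    hd_meas.aestronglyMeasurable hθ₀ hθ.2.le ENNReal.ofReal_ne_top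
    (zero_lt_one.trans_le hp).ne' hp' hpt).trans ?_
  have hu : eLpNorm (fun x => ι₀ (ι₁ (d x))) p
      (volume.restrict {x | x ∈ Set.Icc a b ∧ x + h ∈ Set.Icc a b})
        ≤ ENNReal.ofReal h * eLpNorm g p (volume.restrict (Set.Icc a b)) := by
    simpa only [hd, map_sub] using
      eLpNorm_shift_sub_le (u := fun x => ι₀ (ι₁ (f x))) hg hp hp' hh hftc
  calc _ ≤ ENNReal.ofReal C₀ *
        (ENNReal.ofReal h * eLpNorm g p (volume.restrict (Set.Icc a b))) ^ (1 - θ) *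
        (2 * eLpNorm f p (volume.restrict (Set.Icc a b))) ^ θ := by
        gcongr
        · exact hu
        · exact eLpNorm_shift_sub_le_two_mul hf hp a b h
    _ = _ := by
        rw [ENNReal.mul_rpow_of_nonneg _ _ hθ₁, ENNReal.ofReal_rpow_of_pos hh]
        ring
end
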